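/- Let ε > 0 and let W : ℝ → [0, ∞) be continuous with M := ∫_ℝ (1 + |s|)^{3/2 + ε} W(s) ds < ∞. Let B : [0,∞) × [0,∞) → ℂ be continuous and continuously differentiable in its first variable, with |B(x,z)| ≤ ∫_{x+z}^∞ W(s) ds and |∂_x B(x,z)| ≤ W(x + z) + ∫_{x+z}^∞ W(s) ds for all x, z ≥ 0. Then there is a constant C depending only on ε such that for every p with 1 ≤ p ≤ ∞ and every continuously differentiable compactly supported Φ : ℝ → ℂ, the function (S_1 Φ)(x) = ∫_x^∞ B(x, (y-x)/2) Φ(y) dy is continuously differentiable on (0,∞) with derivative (S_1 Φ)'(x) = ∫_x^∞ ∂_x B(x,(y-x)/2) Φ(y) dy + ∫_x^∞ B(x,(y-x)/2) Φ'(y) dy, and ‖S_1 Φ‖_{L^p((0,∞))} + ‖(S_1 Φ)'‖_{L^p((0,∞))} ≤ C · M · ( ‖Φ‖_{L^p(ℝ)} + ‖Φ'‖_{L^p(ℝ)} ). -/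

import Mathlib

open MeasureTheory Set
open scoped ENNReal

/-- **Schur's test**, for a nonnegative kernel whose row and column integrals are bounded by the
same constant. -/
theorem eLpNorm_lintegral_kernel_le {α β : Type*} [MeasurableSpace α] [MeasurableSpace β]
    {μ : Measure α} {ν : Measure β} [SFinite μ] [SFinite ν] {K : α → β → ℝ≥0∞}
    (hK : Measurable (Function.uncurry K)) {A : ℝ≥0∞} (hA : A ≠ ∞)
    (hrow : ∀ x, ∫⁻ y, K x y ∂ν ≤ A) (hcol : ∀ y, ∫⁻ x, K x y ∂μ ≤ A)
    {f : β → ℝ≥0∞} (hf : Measurable f) {p : ℝ≥0∞} (hp : 1 ≤ p) :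
    eLpNorm (fun x => ∫⁻ y, K x y * f y ∂ν) p μ ≤ A * eLpNorm f p ν := by
  rcases eq_or_ne p ∞ with rfl | hp'
  · rw [eLpNorm_exponent_top, eLpNorm_exponent_top]
    refine eLpNormEssSup_le_of_ae_enorm_bound (ae_of_all _ fun x => ?_)
    calc ∫⁻ y, K x y * f y ∂ν ≤ ∫⁻ y, K x y * eLpNormEssSup f ν ∂ν := by
          refine lintegral_mono_ae ?_
          filter_upwards [ae_le_eLpNormEssSup (f := f) (μ := ν)] with y hy
          exact mul_le_mul_right hy _
      _ = (∫⁻ y, K x y ∂ν) * eLpNormEssSup f ν :=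
          lintegral_mul_const _ hK.of_uncurry_left
      _ ≤ A * eLpNormEssSup f ν := mul_le_mul_left (hrow x) _
  have hp0 : p ≠ 0 := (zero_lt_one.trans_le hp).ne'
  have hr : 1 ≤ p.toReal := by simpa using ENNReal.toReal_mono hp' hp
  have hr0 : 0 < p.toReal := by linarith
  have jensen (x : α) : (∫⁻ y, K x y * f y ∂ν) ^ p.toReal ≤
      A ^ (p.toReal - 1) * ∫⁻ y, K x y * f y ^ p.toReal ∂ν := by
    have hKx : Measurable (K x) := hK.of_uncurry_left
    have h := eLpNorm_le_eLpNorm_mul_rpow_measure_univ (μ := ν.withDensity (K x)) hp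
      hf.aestronglyMeasurable
    rw [eLpNorm_one_eq_lintegral_enorm, eLpNorm_eq_lintegral_rpow_enorm_toReal hp0 hp',
      withDensity_apply _ MeasurableSet.univ, Measure.restrict_univ] at h
    simp only [enorm_eq_self] at h
    rw [lintegral_withDensity_eq_lintegral_mul _ hKx hf,
      lintegral_withDensity_eq_lintegral_mul _ hKx (hf.pow_const _)] at h
    simp only [Pi.mul_apply, ENNReal.toReal_one] at h
    calc (∫⁻ y, K x y * f y ∂ν) ^ p.toReal
        ≤ ((∫⁻ y, K x y * f y ^ p.toReal ∂ν) ^ (1 / p.toReal) *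
          (∫⁻ y, K x y ∂ν) ^ (1 / 1 - 1 / p.toReal)) ^ p.toReal :=
          ENNReal.rpow_le_rpow h hr0.le
      _ = (∫⁻ y, K x y ∂ν) ^ (p.toReal - 1) * ∫⁻ y, K x y * f y ^ p.toReal ∂ν := by
          rw [ENNReal.mul_rpow_of_nonneg _ _ hr0.le, ← ENNReal.rpow_mul, ← ENNReal.rpow_mul,
            one_div_mul_cancel hr0.ne', ENNReal.rpow_one, mul_comm]
          congr 2
          field_simp
      _ ≤ _ := mul_le_mul_left (ENNReal.rpow_le_rpow (hrow x) (by linarith)) _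
  have hKf : Measurable (Function.uncurry fun x y => K x y * f y ^ p.toReal) :=
    hK.mul ((hf.comp measurable_snd).pow_const _)
  rw [eLpNorm_eq_lintegral_rpow_enorm_toReal hp0 hp',
    eLpNorm_eq_lintegral_rpow_enorm_toReal hp0 hp']
  simp only [enorm_eq_self]
  calc (∫⁻ x, (∫⁻ y, K x y * f y ∂ν) ^ p.toReal ∂μ) ^ (1 / p.toReal)
      ≤ (A ^ p.toReal * ∫⁻ y, f y ^ p.toReal ∂ν) ^ (1 / p.toReal) := by
        refine ENNReal.rpow_le_rpow ?_ (by positivity)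
        calc ∫⁻ x, (∫⁻ y, K x y * f y ∂ν) ^ p.toReal ∂μ
            ≤ ∫⁻ x, A ^ (p.toReal - 1) * ∫⁻ y, K x y * f y ^ p.toReal ∂ν ∂μ :=
              lintegral_mono jensen
          _ = A ^ (p.toReal - 1) * ∫⁻ y, ∫⁻ x, K x y * f y ^ p.toReal ∂μ ∂ν := by
              rw [lintegral_const_mul' _ _ (ENNReal.rpow_ne_top_of_nonneg (by linarith) hA),
                lintegral_lintegral_swap hKf.aemeasurable]
          _ ≤ A ^ (p.toReal - 1) * ∫⁻ y, A * f y ^ p.toReal ∂ν := by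
              gcongr with y
              rw [lintegral_mul_const _ hK.of_uncurry_right]
              exact mul_le_mul_left (hcol y) _
          _ = A ^ p.toReal * ∫⁻ y, f y ^ p.toReal ∂ν := by
              rw [lintegral_const_mul' _ _ hA, ← mul_assoc]
              congr 1
              nth_rewrite 2 [← ENNReal.rpow_one A]
              rw [← ENNReal.rpow_add_of_nonneg _ _ (by linarith) zero_le_one, sub_add_cancel]
    _ = A * (∫⁻ y, f y ^ p.toReal ∂ν) ^ (1 / p.toReal) := by
        rw [ENNReal.mul_rpow_of_nonneg _ _ (by positivity), ← ENNReal.rpow_mul,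
          mul_one_div_cancel hr0.ne', ENNReal.rpow_one]

theorem lintegral_comp_div_two {f : ℝ → ℝ≥0∞} (hf : Measurable f) :
    ∫⁻ t, f (t / 2) = 2 * ∫⁻ t, f t := by
  have h := Real.map_volume_mul_left (a := (2 : ℝ)⁻¹) (by norm_num)
  have h2 := lintegral_map (μ := volume) hf (measurable_const_mul (2 : ℝ)⁻¹)
  rw [h, lintegral_smul_measure] at h2
  simp only [div_eq_inv_mul]
  rw [← h2]
  simp

/-- The mass of `W` beyond `t`. -/
noncomputable def tailMass (W : ℝ → ℝ) (t : ℝ) : ℝ≥0∞ := ∫⁻ s in Ioi t, ENNReal.ofReal (W s)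

theorem tailMass_antitone (W : ℝ → ℝ) : Antitone (tailMass W) := fun _ _ h =>
  lintegral_mono_set (Ioi_subset_Ioi h)

theorem lintegral_Ioi_tailMass {W : ℝ → ℝ} (hW : Measurable W) :
    ∫⁻ t in Ioi 0, tailMass W t = ∫⁻ s, ENNReal.ofReal s * ENNReal.ofReal (W s) := by
  have hm : Measurable (Function.uncurry fun t s : ℝ =>
      (Ioi t).indicator (fun s => ENNReal.ofReal (W s)) s) := by
    have : MeasurableSet {q : ℝ × ℝ | q.1 < q.2} := measurableSet_lt measurable_fst measurable_snd
    exact (hW.ennreal_ofReal.comp measurable_snd).indicator this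
  simp only [tailMass, ← lintegral_indicator measurableSet_Ioi]
  rw [lintegral_indicator measurableSet_Ioi, lintegral_lintegral_swap hm.aemeasurable]
  congr 1 with s
  have (t : ℝ) : (Ioi t).indicator (fun s => ENNReal.ofReal (W s)) s =
      (Iio s).indicator (fun _ => ENNReal.ofReal (W s)) t := by
    simp [indicator_apply]
  simp only [this]
  rw [lintegral_indicator_const measurableSet_Iio, Measure.restrict_apply measurableSet_Iio,
    inter_comm, Ioi_inter_Iio, Real.volume_Ioo, sub_zero, mul_comm]

/-- The kernel `(x, y) ↦ 1_{x < y} ∫_{(y - x) / 2}^∞ W + W ((x + y) / 2)`. -/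
noncomputable def majorant (W : ℝ → ℝ) (x y : ℝ) : ℝ≥0∞ :=
  (Ioi 0).indicator (fun t => tailMass W (t / 2)) (y - x) + ENNReal.ofReal (W ((x + y) / 2))

theorem measurable_majorant {W : ℝ → ℝ} (hW : Measurable W) :
    Measurable (Function.uncurry (majorant W)) := by
  have h1 : Measurable ((Ioi 0).indicator fun t => tailMass W (t / 2)) :=
    ((tailMass_antitone W).measurable.comp (measurable_id.div_const 2)).indicator measurableSet_Ioi
  exact (h1.comp (measurable_snd.sub measurable_fst)).add
    (hW.comp ((measurable_fst.add measurable_snd).div_const 2)).ennreal_ofReal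

theorem lintegral_majorant {W : ℝ → ℝ} (hW : Measurable W) :
    (∀ x, ∫⁻ y, majorant W x y = 2 * (∫⁻ s, ENNReal.ofReal s * ENNReal.ofReal (W s)) +
        2 * ∫⁻ s, ENNReal.ofReal (W s)) ∧
      ∀ y, ∫⁻ x, majorant W x y = 2 * (∫⁻ s, ENNReal.ofReal s * ENNReal.ofReal (W s)) +
        2 * ∫⁻ s, ENNReal.ofReal (W s) := by
  have hg : Measurable ((Ioi 0).indicator (tailMass W)) :=
    (tailMass_antitone W).measurable.indicator measurableSet_Ioi
  have h1 : ((Ioi 0).indicator fun t => tailMass W (t / 2)) =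
      fun t => (Ioi 0).indicator (tailMass W) (t / 2) := by
    ext t; simp [indicator_apply]
  have hg2 : Measurable fun t : ℝ => (Ioi 0).indicator (tailMass W) (t / 2) :=
    hg.comp (measurable_id.div_const 2)
  have e1 : ∫⁻ t : ℝ, (Ioi 0).indicator (tailMass W) (t / 2) =
      2 * ∫⁻ s, ENNReal.ofReal s * ENNReal.ofReal (W s) := by
    rw [lintegral_comp_div_two hg, lintegral_indicator measurableSet_Ioi, lintegral_Ioi_tailMass hW]
  have e2 := lintegral_comp_div_two hW.ennreal_ofReal
  simp only [majorant, h1]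
  constructor
  · intro x
    have hx : Measurable fun y : ℝ => (Ioi 0).indicator (tailMass W) ((y - x) / 2) :=
      hg2.comp (measurable_id.sub_const x)
    rw [lintegral_add_left hx,
      lintegral_sub_right_eq_self (fun t : ℝ => (Ioi 0).indicator (tailMass W) (t / 2)) x, e1,
      lintegral_add_left_eq_self (fun t : ℝ => ENNReal.ofReal (W (t / 2))) x, e2]
  · intro y
    have hy : Measurable fun x : ℝ => (Ioi 0).indicator (tailMass W) ((y - x) / 2) :=
      hg2.comp (measurable_const.sub measurable_id)
    rw [lintegral_add_left hy,
      lintegral_sub_left_eq_self (fun t : ℝ => (Ioi 0).indicator (tailMass W) (t / 2)) y, e1,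
      lintegral_add_right_eq_self (fun t : ℝ => ENNReal.ofReal (W (t / 2))) y, e2]

section Kernel

variable {b : ℝ → ℝ → ℂ} {φ : ℝ → ℂ}

theorem setIntegral_kernel_mul_eq (b : ℝ → ℝ → ℂ) (φ : ℝ → ℂ) (x : ℝ) :
    ∫ y in Ioi x, b x ((y - x) / 2) * φ y = 2 * ∫ z in Ioi 0, b x z * φ (x + 2 * z) := by
  have h := integral_comp_mul_left_Ioi (fun u => b x (u / 2) * φ (x + u)) 0 (b := 2) two_pos
  have h2 := (measurePreserving_add_left volume x).setIntegral_preimage_emb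
    (measurableEmbedding_addLeft x) (fun y => b x ((y - x) / 2) * φ y) (Ioi x)
  simp only [mul_div_cancel_left₀ _ (two_ne_zero' ℝ)] at h
  rw [h, ← h2]
  simp

theorem aestronglyMeasurable_kernel_mul (hb : ContinuousOn (Function.uncurry b) (Ici 0 ×ˢ Ici 0))
    (hφ : Continuous φ) {x : ℝ} (hx : 0 ≤ x) :
    AEStronglyMeasurable (fun z => b x z * φ (x + 2 * z)) (volume.restrict (Ioi 0)) := by
  have h : ContinuousOn (b x) (Ioi 0) := hb.comp (f := fun z => (x, z)) (by fun_prop)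
    fun z hz => ⟨hx, Ioi_subset_Ici_self hz⟩
  exact (h.mul (by fun_prop)).aestronglyMeasurable measurableSet_Ioi

theorem exists_integrable_bound_kernel_mul
    (hb : ContinuousOn (Function.uncurry b) (Ici 0 ×ˢ Ici 0))
    (hφ : Continuous φ) (hφs : HasCompactSupport φ) (X : ℝ) :
    ∃ bound : ℝ → ℝ, Integrable bound (volume.restrict (Ioi 0)) ∧
      ∀ x ∈ Icc 0 X, ∀ z ∈ Ioi (0 : ℝ), ‖b x z * φ (x + 2 * z)‖ ≤ bound z := by
  obtain ⟨R, hR⟩ := hφs.isCompact.isBounded.subset_closedBall 0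
  obtain ⟨K, hK⟩ := (isCompact_Icc (a := (0 : ℝ)) (b := X)).prod
    (isCompact_Icc (a := (0 : ℝ)) (b := R)) |>.exists_bound_of_continuousOn
      (hb.mono (prod_mono Icc_subset_Ici_self Icc_subset_Ici_self))
  obtain ⟨L, hL⟩ := hφs.exists_bound_of_continuous hφ
  refine ⟨(Icc 0 R).indicator fun _ => K * L, ?_, fun x hx z hz => ?_⟩
  · exact ((integrable_indicator_iff measurableSet_Icc).2
      (integrableOn_const (by simp))).integrableOn
  · by_cases hzR : z ≤ R
    · rw [indicator_of_mem (show z ∈ Icc 0 R from ⟨le_of_lt hz, hzR⟩), norm_mul]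
      have h1 : ‖b x z‖ ≤ K := hK (x, z) ⟨hx, le_of_lt hz, hzR⟩
      exact mul_le_mul h1 (hL _) (norm_nonneg _) ((norm_nonneg _).trans h1)
    · rw [indicator_of_notMem fun h => hzR h.2]
      have : φ (x + 2 * z) = 0 := by
        refine image_eq_zero_of_notMem_tsupport fun h => hzR ?_
        have h2 := hR h
        rw [mem_closedBall_zero_iff, Real.norm_eq_abs] at h2
        have := (le_abs_self _).trans h2
        linarith [hx.1, mem_Ioi.1 hz]
      simp [this]

theorem integrableOn_kernel_mul (hb : ContinuousOn (Function.uncurry b) (Ici 0 ×ˢ Ici 0))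
    (hφ : Continuous φ) (hφs : HasCompactSupport φ) {x : ℝ} (hx : 0 ≤ x) :
    IntegrableOn (fun z => b x z * φ (x + 2 * z)) (Ioi 0) := by
  obtain ⟨bound, hi, hbd⟩ := exists_integrable_bound_kernel_mul hb hφ hφs x
  refine Integrable.mono' hi (aestronglyMeasurable_kernel_mul hb hφ hx) ?_
  filter_upwards [ae_restrict_mem measurableSet_Ioi] with z hz
  exact hbd x ⟨hx, le_rfl⟩ z hz

theorem continuousOn_setIntegral_kernel_mul
    (hb : ContinuousOn (Function.uncurry b) (Ici 0 ×ˢ Ici 0))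
    (hφ : Continuous φ) (hφs : HasCompactSupport φ) :
    ContinuousOn (fun x => ∫ y in Ioi x, b x ((y - x) / 2) * φ y) (Ioi 0) := by
  intro x₀ hx₀
  have hx₀ : 0 < x₀ := hx₀
  simp only [setIntegral_kernel_mul_eq b φ]
  obtain ⟨bound, hi, hbd⟩ := exists_integrable_bound_kernel_mul hb hφ hφs (2 * x₀)
  have hnhds : Icc 0 (2 * x₀) ∈ nhds x₀ := Icc_mem_nhds hx₀ (by linarith)
  refine (continuousAt_const.mul (continuousAt_of_dominated ?_ ?_ hi ?_)).continuousWithinAt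
  · filter_upwards [hnhds] with x hx using aestronglyMeasurable_kernel_mul hb hφ hx.1
  · filter_upwards [hnhds] with x hx
    filter_upwards [ae_restrict_mem measurableSet_Ioi] with z hz using hbd x hx z hz
  · filter_upwards [ae_restrict_mem measurableSet_Ioi] with z hz
    have h1 : ContinuousAt (Function.uncurry b) (x₀, z) :=
      hb.continuousAt (prod_mem_nhds (Ici_mem_nhds hx₀) (Ici_mem_nhds hz))
    have h2 : ContinuousAt (fun x => b x z) x₀ :=
      ContinuousAt.comp (f := fun x => (x, z)) h1 (by fun_prop)
    exact h2.mul (by fun_prop)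

theorem hasDerivAt_setIntegral_kernel_mul {b' : ℝ → ℝ → ℂ}
    (hb : ContinuousOn (Function.uncurry b) (Ici 0 ×ˢ Ici 0))
    (hb' : ContinuousOn (Function.uncurry b') (Ici 0 ×ˢ Ici 0))
    (hd : ∀ z : ℝ, 0 ≤ z → ∀ x : ℝ, 0 ≤ x →
      HasDerivWithinAt (fun x' => b x' z) (b' x z) (Ici 0) x)
    (hφ : ContDiff ℝ 1 φ) (hφs : HasCompactSupport φ) {x₀ : ℝ} (hx₀ : 0 < x₀) :
    HasDerivAt (fun x => ∫ y in Ioi x, b x ((y - x) / 2) * φ y)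
      ((∫ y in Ioi x₀, b' x₀ ((y - x₀) / 2) * φ y)
        + ∫ y in Ioi x₀, b x₀ ((y - x₀) / 2) * deriv φ y) x₀ := by
  simp only [setIntegral_kernel_mul_eq b φ, setIntegral_kernel_mul_eq b' φ,
    setIntegral_kernel_mul_eq b (deriv φ)]
  have hφ' : Continuous (deriv φ) := hφ.continuous_deriv le_rfl
  have hφ's : HasCompactSupport (deriv φ) := hφs.deriv
  have hφc := hφ.continuous
  obtain ⟨bd1, hi1, hbd1⟩ := exists_integrable_bound_kernel_mul hb' hφc hφs (2 * x₀)
  obtain ⟨bd2, hi2, hbd2⟩ := exists_integrable_bound_kernel_mul hb hφ' hφ's (2 * x₀)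
  have hnhds : Ioo 0 (2 * x₀) ∈ nhds x₀ := Ioo_mem_nhds hx₀ (by linarith)
  rw [← mul_add, ← integral_add (integrableOn_kernel_mul hb' hφc hφs hx₀.le)
    (integrableOn_kernel_mul hb hφ' hφ's hx₀.le)]
  refine HasDerivAt.const_mul 2 (hasDerivAt_integral_of_dominated_loc_of_deriv_le
    (F := fun x z => b x z * φ (x + 2 * z))
    (F' := fun x z => b' x z * φ (x + 2 * z) + b x z * deriv φ (x + 2 * z))
    (bound := fun z => bd1 z + bd2 z) hnhds ?_
    (integrableOn_kernel_mul hb hφc hφs hx₀.le) ?_ ?_ (hi1.add hi2) ?_).2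
  · filter_upwards [hnhds] with x hx using aestronglyMeasurable_kernel_mul hb hφc hx.1.le
  · exact (aestronglyMeasurable_kernel_mul hb' hφc hx₀.le).add
      (aestronglyMeasurable_kernel_mul hb hφ' hx₀.le)
  · filter_upwards [ae_restrict_mem measurableSet_Ioi] with z hz x hx
    exact (norm_add_le _ _).trans (add_le_add (hbd1 x (Ioo_subset_Icc_self hx) z hz)
      (hbd2 x (Ioo_subset_Icc_self hx) z hz))
  · filter_upwards [ae_restrict_mem measurableSet_Ioi] with z hz x hx
    have h1 : HasDerivAt (fun x' => b x' z) (b' x z) x :=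
      (hd z (le_of_lt hz) x hx.1.le).hasDerivAt (Ici_mem_nhds hx.1)
    have h2 : HasDerivAt φ (deriv φ (x + 2 * z)) (x + 2 * z) :=
      (hφ.differentiable one_ne_zero _).hasDerivAt
    exact h1.mul (h2.comp_add_const x (2 * z))

theorem enorm_setIntegral_kernel_mul_le {W : ℝ → ℝ} {x : ℝ}
    (h : ∀ z : ℝ, 0 < z → ‖b x z‖ₑ ≤ ENNReal.ofReal (W (x + z)) + tailMass W z) :
    ‖∫ y in Ioi x, b x ((y - x) / 2) * φ y‖ₑ ≤ ∫⁻ y, majorant W x y * ‖φ y‖ₑ := by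
  refine (enorm_integral_le_lintegral_enorm _).trans ?_
  refine le_trans ?_ (setLIntegral_le_lintegral (Ioi x) _)
  refine setLIntegral_mono' measurableSet_Ioi fun y hy => ?_
  rw [enorm_mul]
  refine mul_le_mul_left ?_ _
  have hyx : 0 < y - x := sub_pos.2 hy
  have := h ((y - x) / 2) (by linarith)
  rwa [show x + (y - x) / 2 = (x + y) / 2 by ring, add_comm,
    ← indicator_of_mem (show y - x ∈ Ioi (0 : ℝ) from hyx) fun t => tailMass W (t / 2)] at this

end Kernel

/-- Lemma 6.1 of the paper: if the kernel `B(x,z)` (defined for `x, z ≥ 0`, continuous, and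
continuously differentiable in `x` with partial derivative `Bx`) obeys the Deift–Trubowitz
bounds `|B(x,z)| ≤ ∫_{x+z}^∞ W` and `|∂ₓB(x,z)| ≤ W(x+z) + ∫_{x+z}^∞ W` with respect to a
continuous nonnegative weight `W` with `M = ∫ (1+|s|)^{3/2+ε} W(s) ds < ∞`, then there is
`C = C(ε)` such that for every `1 ≤ p ≤ ∞` and every `C¹` compactly supported `Φ`, the
function `(S₁Φ)(x) = ∫_x^∞ B(x,(y-x)/2) Φ(y) dy` is continuously differentiable on `(0,∞)`
with the expected derivative, and
`‖S₁Φ‖_{L^p((0,∞))} + ‖(S₁Φ)'‖_{L^p((0,∞))} ≤ C·M·(‖Φ‖_{L^p} + ‖Φ'‖_{L^p})`. -/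
theorem S1_W1p_bound (ε : ℝ) (hε : 0 < ε) :
    ∃ C > 0, ∀ W : ℝ → ℝ, Continuous W → (∀ s, 0 ≤ W s) →
      Integrable (fun s => (1 + |s|) ^ ((3 : ℝ) / 2 + ε) * W s) →
      ∀ B Bx : ℝ → ℝ → ℂ,
      ContinuousOn (Function.uncurry B) (Ici 0 ×ˢ Ici 0) →
      ContinuousOn (Function.uncurry Bx) (Ici 0 ×ˢ Ici 0) →
      (∀ z : ℝ, 0 ≤ z → ∀ x : ℝ, 0 ≤ x →
        HasDerivWithinAt (fun x' => B x' z) (Bx x z) (Ici 0) x) →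
      (∀ x : ℝ, 0 ≤ x → ∀ z : ℝ, 0 ≤ z →
        ‖B x z‖ ≤ ∫ s in Ioi (x + z), W s) →
      (∀ x : ℝ, 0 ≤ x → ∀ z : ℝ, 0 ≤ z →
        ‖Bx x z‖ ≤ W (x + z) + ∫ s in Ioi (x + z), W s) →
      ∀ p : ℝ≥0∞, 1 ≤ p → ∀ Φ : ℝ → ℂ, ContDiff ℝ 1 Φ → HasCompactSupport Φ →
        (∀ x ∈ Ioi (0 : ℝ),
          HasDerivAt (fun x => ∫ y in Ioi x, B x ((y - x) / 2) * Φ y)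
            ((∫ y in Ioi x, Bx x ((y - x) / 2) * Φ y)
              + ∫ y in Ioi x, B x ((y - x) / 2) * deriv Φ y) x) ∧
        ContinuousOn (fun x => (∫ y in Ioi x, Bx x ((y - x) / 2) * Φ y)
              + ∫ y in Ioi x, B x ((y - x) / 2) * deriv Φ y) (Ioi 0) ∧
        eLpNorm (fun x => ∫ y in Ioi x, B x ((y - x) / 2) * Φ y) p (volume.restrict (Ioi 0))
          + eLpNorm (fun x => (∫ y in Ioi x, Bx x ((y - x) / 2) * Φ y)
              + ∫ y in Ioi x, B x ((y - x) / 2) * deriv Φ y) p (volume.restrict (Ioi 0))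
          ≤ ENNReal.ofReal (C * ∫ s : ℝ, (1 + |s|) ^ ((3 : ℝ) / 2 + ε) * W s)
            * (eLpNorm Φ p volume + eLpNorm (deriv Φ) p volume) := by
  refine ⟨8, by norm_num, fun W hW hW0 hM B Bx hB hBx hd hBb hBxb p hp Φ hΦ hΦs => ?_⟩
  have hΦ' : Continuous (deriv Φ) := hΦ.continuous_deriv le_rfl
  have hΦ's : HasCompactSupport (deriv Φ) := hΦs.deriv
  have hdc : ContinuousOn (fun x => (∫ y in Ioi x, Bx x ((y - x) / 2) * Φ y)
      + ∫ y in Ioi x, B x ((y - x) / 2) * deriv Φ y) (Ioi 0) :=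
    (continuousOn_setIntegral_kernel_mul hBx hΦ.continuous hΦs).add
      (continuousOn_setIntegral_kernel_mul hB hΦ' hΦ's)
  refine ⟨fun x hx => hasDerivAt_setIntegral_kernel_mul hB hBx hd hΦ hΦs hx, hdc, ?_⟩
  have hbase (s : ℝ) : 1 + |s| ≤ (1 + |s|) ^ ((3 : ℝ) / 2 + ε) :=
    Real.self_le_rpow_of_one_le (by linarith [abs_nonneg s]) (by linarith)
  have hWM (s : ℝ) : W s ≤ (1 + |s|) ^ ((3 : ℝ) / 2 + ε) * W s :=
    le_mul_of_one_le_left (hW0 s) (by linarith [abs_nonneg s, hbase s])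
  have hWi : Integrable W := hM.mono' hW.aestronglyMeasurable
    (ae_of_all _ fun s => by rw [Real.norm_of_nonneg (hW0 s)]; exact hWM s)
  set M := ∫ s : ℝ, (1 + |s|) ^ ((3 : ℝ) / 2 + ε) * W s with hMdef
  have hMl : ENNReal.ofReal M = ∫⁻ s, ENNReal.ofReal ((1 + |s|) ^ ((3 : ℝ) / 2 + ε) * W s) :=
    ofReal_integral_eq_lintegral_ofReal hM
      (ae_of_all _ fun s => mul_nonneg (by positivity) (hW0 s))
  have h1 : ∫⁻ s, ENNReal.ofReal (W s) ≤ ENNReal.ofReal M := by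
    rw [hMl]
    exact lintegral_mono fun s => ENNReal.ofReal_le_ofReal (hWM s)
  have h2 : ∫⁻ s, ENNReal.ofReal s * ENNReal.ofReal (W s) ≤ ENNReal.ofReal M := by
    rw [hMl]
    refine lintegral_mono fun s => ?_
    rw [← ENNReal.ofReal_mul' (hW0 s)]
    exact ENNReal.ofReal_le_ofReal (mul_le_mul_of_nonneg_right
      (by linarith [le_abs_self s, hbase s]) (hW0 s))
  have hmass : 2 * (∫⁻ s, ENNReal.ofReal s * ENNReal.ofReal (W s)) +
      2 * ∫⁻ s, ENNReal.ofReal (W s) ≤ ENNReal.ofReal (4 * M) := by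
    calc _ ≤ 2 * ENNReal.ofReal M + 2 * ENNReal.ofReal M := by gcongr
      _ = ENNReal.ofReal (4 * M) := by
        rw [← add_mul, ENNReal.ofReal_mul (by norm_num)]
        norm_num
  have htail (x : ℝ) (hx : 0 < x) (z : ℝ) :
      ENNReal.ofReal (∫ s in Ioi (x + z), W s) ≤ tailMass W z := by
    rw [ofReal_integral_eq_lintegral_ofReal hWi.integrableOn (ae_of_all _ hW0)]
    exact tailMass_antitone W (by linarith)
  have hBe (x : ℝ) (hx : 0 < x) (z : ℝ) (hz : 0 < z) :
      ‖B x z‖ₑ ≤ ENNReal.ofReal (W (x + z)) + tailMass W z := by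
    rw [← ofReal_norm]
    exact ((ENNReal.ofReal_le_ofReal (hBb x hx.le z hz.le)).trans (htail x hx z)).trans
      le_add_self
  have hBxe (x : ℝ) (hx : 0 < x) (z : ℝ) (hz : 0 < z) :
      ‖Bx x z‖ₑ ≤ ENNReal.ofReal (W (x + z)) + tailMass W z := by
    rw [← ofReal_norm]
    exact (ENNReal.ofReal_le_ofReal (hBxb x hx.le z hz.le)).trans
      (ENNReal.ofReal_add_le.trans (add_le_add_right (htail x hx z) _))
  obtain ⟨hrow, hcol⟩ := lintegral_majorant hW.measurable
  have key {b : ℝ → ℝ → ℂ} {φ : ℝ → ℂ} (hφ : Continuous φ)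
      (hb : ∀ x : ℝ, 0 < x → ∀ z : ℝ, 0 < z →
        ‖b x z‖ₑ ≤ ENNReal.ofReal (W (x + z)) + tailMass W z) :
      eLpNorm (fun x => ∫ y in Ioi x, b x ((y - x) / 2) * φ y) p (volume.restrict (Ioi 0)) ≤
        ENNReal.ofReal (4 * M) * eLpNorm φ p volume := by
    calc _ ≤ eLpNorm (fun x => ∫⁻ y, majorant W x y * ‖φ y‖ₑ) p (volume.restrict (Ioi 0)) := by
          refine eLpNorm_mono_enorm_ae ?_
          filter_upwards [ae_restrict_mem measurableSet_Ioi] with x hx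
          exact enorm_setIntegral_kernel_mul_le (hb x hx)
      _ ≤ eLpNorm (fun x => ∫⁻ y, majorant W x y * ‖φ y‖ₑ) p volume :=
          eLpNorm_mono_measure _ Measure.restrict_le_self
      _ ≤ ENNReal.ofReal (4 * M) * eLpNorm (fun y => ‖φ y‖ₑ) p volume :=
          eLpNorm_lintegral_kernel_le (measurable_majorant hW.measurable) ENNReal.ofReal_ne_top
            (fun x => (hrow x).trans_le hmass) (fun y => (hcol y).trans_le hmass)
            hφ.enorm.measurable hp
      _ = _ := by rw [eLpNorm_enorm]
  have hm1 := (continuousOn_setIntegral_kernel_mul hBx hΦ.continuous hΦs).aestronglyMeasurable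
    (μ := volume) measurableSet_Ioi
  have hm2 := (continuousOn_setIntegral_kernel_mul hB hΦ' hΦ's).aestronglyMeasurable
    (μ := volume) measurableSet_Ioi
  set A := ENNReal.ofReal (4 * M) with hA
  have h8 : ENNReal.ofReal (8 * M) = 2 * A := by
    rw [hA, show 8 * M = 2 * (4 * M) by ring, ENNReal.ofReal_mul zero_le_two, ENNReal.ofReal_ofNat]
  calc _ ≤ A * eLpNorm Φ p volume + (A * eLpNorm Φ p volume + A * eLpNorm (deriv Φ) p volume) :=
        add_le_add (key hΦ.continuous hBe) ((eLpNorm_add_le hm1 hm2 hp).trans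
          (add_le_add (key hΦ.continuous hBxe) (key hΦ' hBe)))
    _ ≤ A * eLpNorm Φ p volume + (A * eLpNorm Φ p volume + A * eLpNorm (deriv Φ) p volume) +
        A * eLpNorm (deriv Φ) p volume := le_self_add
    _ = _ := by rw [h8]; ring
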